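/- Let σ > 0, f ∈ (ℰ_σ^∞)_+, and x ∈ ℝ. Then (1/(2πσ)) ∫_ℝ |f(x) − f(t)|²/(x − t)² dt ≤ (4/π) ‖f‖²_{L^∞(ℝ)}. -/

import Mathlib

open MeasureTheory

/-- The class `(ℰ_σ^∞)₊`: entire functions that are bounded on the closed upper half-plane
and such that `e^{-iσz} f(z)` is bounded on the closed lower half-plane (equivalently,
bounded functions on `ℝ` whose Fourier transform is supported in `[0, σ]`). -/
def MemEInftyPlus (σ : ℝ) (f : ℂ → ℂ) : Prop :=
  Differentiable ℂ f ∧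
  (∃ C : ℝ, ∀ z : ℂ, 0 ≤ z.im → ‖f z‖ ≤ C) ∧
  (∃ C : ℝ, ∀ z : ℂ, z.im ≤ 0 → ‖Complex.exp (-(Complex.I * (σ : ℂ) * z)) * f z‖ ≤ C)

/-- The factor `(e^{iσy} − 1)/(i(σy − 2πn))`, understood as the value `1` of its entire
extension when `σy = 2πn`. -/
noncomputable def sincFac (σ : ℝ) (n : ℤ) (y : ℝ) : ℂ :=
  if σ * y = 2 * Real.pi * n then 1
  else (Complex.exp (Complex.I * ((σ * y : ℝ) : ℂ)) - 1) /
    (Complex.I * (((σ * y : ℝ) : ℂ) - ((2 * Real.pi * n : ℝ) : ℂ)))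

/-- If `g` is entire and `‖z‖² ‖g z‖ ≤ C` on the closed upper half-plane, then the integral of `g`
over `[-R, R]` is at most `4 C / R`. -/
theorem norm_integral_le_of_sq_mul_norm_le {g : ℂ → ℂ} (hg : Differentiable ℂ g) {C : ℝ}
    (hC : ∀ z : ℂ, 0 ≤ z.im → ‖z‖ ^ 2 * ‖g z‖ ≤ C) {R : ℝ} (hR : 0 < R) :
    ‖∫ s in (-R)..R, g (s : ℂ)‖ ≤ 4 * C / R := by
  have hfar : ∀ z : ℂ, 0 ≤ z.im → R ≤ ‖z‖ → ‖g z‖ ≤ C / R ^ 2 := by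
    intro z hz hRz
    rw [le_div_iff₀ (by positivity)]
    calc ‖g z‖ * R ^ 2 ≤ ‖g z‖ * ‖z‖ ^ 2 := by gcongr
      _ ≤ C := by rw [mul_comm]; exact hC z hz
  have hrect := Complex.integral_boundary_rect_eq_zero_of_differentiableOn g
    (-R : ℝ) ((R : ℂ) + R * Complex.I) hg.differentiableOn
  simp only [Complex.ofReal_re, Complex.ofReal_im, Complex.add_re, Complex.add_im, Complex.mul_re,
    Complex.mul_im, Complex.I_re, Complex.I_im, mul_zero, mul_one, sub_zero, add_zero, zero_add,
    Complex.ofReal_zero, zero_mul] at hrect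
  have htop : ‖∫ s in (-R)..R, g (s + R * Complex.I)‖ ≤ C / R ^ 2 * |R - (-R)| := by
    refine intervalIntegral.norm_integral_le_of_norm_le_const fun s _ => hfar _ ?_ ?_
    · simpa using hR.le
    · simpa [abs_of_pos hR] using Complex.abs_im_le_norm ((s : ℂ) + R * Complex.I)
  have hright : ‖∫ y in (0 : ℝ)..R, g (R + y * Complex.I)‖ ≤ C / R ^ 2 * |R - 0| := by
    refine intervalIntegral.norm_integral_le_of_norm_le_const fun y hy => hfar _ ?_ ?_
    · rw [Set.uIoc_of_le hR.le] at hy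
      simpa using hy.1.le
    · simpa [abs_of_pos hR] using Complex.abs_re_le_norm ((R : ℂ) + y * Complex.I)
  have hleft : ‖∫ y in (0 : ℝ)..R, g ((-R : ℝ) + y * Complex.I)‖ ≤ C / R ^ 2 * |R - 0| := by
    refine intervalIntegral.norm_integral_le_of_norm_le_const fun y hy => hfar _ ?_ ?_
    · rw [Set.uIoc_of_le hR.le] at hy
      simpa using hy.1.le
    · simpa [abs_of_pos hR] using Complex.abs_re_le_norm (((-R : ℝ) : ℂ) + y * Complex.I)
  have hsolve : ∫ s in (-R)..R, g (s : ℂ) = (∫ s in (-R)..R, g (s + R * Complex.I)) -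
      Complex.I • (∫ y in (0 : ℝ)..R, g (R + y * Complex.I)) +
      Complex.I • (∫ y in (0 : ℝ)..R, g ((-R : ℝ) + y * Complex.I)) := by
    linear_combination hrect
  rw [hsolve]
  calc _ ≤ ‖∫ s in (-R)..R, g (s + R * Complex.I)‖ +
        ‖Complex.I • (∫ y in (0 : ℝ)..R, g (R + y * Complex.I))‖ +
        ‖Complex.I • (∫ y in (0 : ℝ)..R, g ((-R : ℝ) + y * Complex.I))‖ :=
        (norm_add_le _ _).trans (add_le_add_left (norm_sub_le _ _) _)
    _ ≤ C / R ^ 2 * |R - (-R)| + C / R ^ 2 * |R - 0| + C / R ^ 2 * |R - 0| := by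
        simp only [norm_smul, Complex.norm_I, one_mul]
        gcongr
    _ = 4 * C / R := by
        rw [sub_neg_eq_add, sub_zero, abs_of_pos hR, abs_of_pos (by positivity)]
        field_simp
        ring

/-- Lower half-plane version of `norm_integral_le_of_sq_mul_norm_le`. -/
theorem norm_integral_le_of_sq_mul_norm_le_lower {g : ℂ → ℂ} (hg : Differentiable ℂ g) {C : ℝ}
    (hC : ∀ z : ℂ, z.im ≤ 0 → ‖z‖ ^ 2 * ‖g z‖ ≤ C) {R : ℝ} (hR : 0 < R) :
    ‖∫ s in (-R)..R, g (s : ℂ)‖ ≤ 4 * C / R := by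
  have h := norm_integral_le_of_sq_mul_norm_le (g := fun z => g (-z)) (C := C)
    (hg.comp differentiable_neg) (fun z hz => by simpa using hC (-z) (by simpa using hz)) hR
  have hneg := intervalIntegral.integral_comp_neg (a := -R) (b := R) fun s : ℝ => g (s : ℂ)
  simp only [Complex.ofReal_neg, neg_neg] at hneg
  rwa [hneg] at h

theorem Differentiable.dslope_complex {F : ℂ → ℂ} (hF : Differentiable ℂ F) (c : ℂ) :
    Differentiable ℂ (dslope F c) :=
  differentiableOn_univ.1 ((Complex.differentiableOn_dslope Filter.univ_mem).2 hF.differentiableOn)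

/-- **Bernstein's inequality** at the origin. -/
theorem MemEInftyPlus.norm_deriv_zero_le {σ : ℝ} (hσ : 0 < σ) {F : ℂ → ℂ}
    (hF : MemEInftyPlus σ F) {M : ℝ} (hM : ∀ t : ℝ, ‖F (t : ℂ)‖ ≤ M) :
    ‖deriv F 0‖ ≤ σ * M := by
  obtain ⟨hd, ⟨A, hA⟩, ⟨B, hB⟩⟩ := hF
  have hσ' : (σ : ℂ) ≠ 0 := by exact_mod_cast hσ.ne'
  set a : ℂ := deriv F 0 / (Complex.I * σ) with ha
  set c : ℂ := F 0 - a with hc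
  set E : ℂ → ℂ := fun z => Complex.exp (-(Complex.I * σ * z)) with hE
  set e : ℂ → ℂ := fun z => Complex.exp (Complex.I * σ * z) with he
  have hEd : Differentiable ℂ E := by fun_prop
  have hEe : ∀ z, E z * e z = 1 := fun z => by simp [hE, he, ← Complex.exp_add]
  have hElow : ∀ z : ℂ, z.im ≤ 0 → ‖E z‖ ≤ 1 := fun z hz => by
    simp only [hE, Complex.norm_exp, Real.exp_le_one_iff]
    simpa using mul_nonpos_of_nonneg_of_nonpos hσ.le hz
  have heup : ∀ z : ℂ, 0 ≤ z.im → ‖e z‖ ≤ 1 := fun z hz => by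
    simp only [he, Complex.norm_exp, Real.exp_le_one_iff]
    simpa using mul_nonneg hσ.le hz
  -- subtract from `F` the combination of `1` and `e` with the same 1-jet at `0`
  set G : ℂ → ℂ := fun z => F z - c - a * e z with hG
  have hGd : Differentiable ℂ G := by fun_prop
  have hG0 : G 0 = 0 := by simp [hG, hc, he]
  have hG1 : deriv G 0 = 0 := by
    have h1 : HasDerivAt e (Complex.I * σ) 0 := by
      simpa [he] using ((hasDerivAt_id (0 : ℂ)).const_mul (Complex.I * σ)).cexp
    have h2 : HasDerivAt G (deriv F 0 - a * (Complex.I * σ)) 0 :=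
      ((hd 0).hasDerivAt.sub_const c).sub (h1.const_mul a)
    rw [h2.deriv, ha]
    field_simp
    simp
  set q : ℂ → ℂ := dslope (dslope G 0) 0 with hq
  have hqd : Differentiable ℂ q := (hGd.dslope_complex 0).dslope_complex 0
  have hqG : ∀ z, z ^ 2 * q z = G z := fun z => by
    have h1 := sub_smul_dslope G 0 z
    have h2 := sub_smul_dslope (dslope G 0) 0 z
    rw [dslope_same, hG1] at h2
    simp only [smul_eq_mul, sub_zero, hG0] at h1 h2
    rw [← h1, ← h2, hq]
    ring
  set d : ℂ → ℂ := dslope E 0 with hdE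
  have hdd : Differentiable ℂ d := hEd.dslope_complex 0
  have hzd : ∀ z, z * d z = E z - 1 := fun z => by
    simpa [hE] using sub_smul_dslope E 0 z
  have hd0 : d 0 = -(Complex.I * σ) := by
    have h1 : HasDerivAt E (-(Complex.I * σ)) 0 := by
      simpa [hE] using ((hasDerivAt_id (0 : ℂ)).const_mul (Complex.I * σ)).neg.cexp
    rw [hdE, dslope_same, h1.deriv]
  set P : ℂ → ℂ := fun z => q z * (E z ^ 2 - 2 * E z) + c * d z ^ 2 with hP
  have hPd : Differentiable ℂ P := by fun_prop
  have hup : ∀ z : ℂ, 0 ≤ z.im → ‖z‖ ^ 2 * ‖q z‖ ≤ A + ‖c‖ + ‖a‖ := fun z hz => by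
    rw [← norm_pow, ← norm_mul, hqG]
    calc ‖F z - c - a * e z‖ ≤ ‖F z‖ + ‖c‖ + ‖a * e z‖ :=
          (norm_sub_le _ _).trans (add_le_add_left (norm_sub_le _ _) _)
      _ ≤ A + ‖c‖ + ‖a‖ := by
          rw [norm_mul]
          gcongr
          · exact hA z hz
          · exact mul_le_of_le_one_right (norm_nonneg _) (heup z hz)
  have hlow : ∀ z : ℂ, z.im ≤ 0 → ‖z‖ ^ 2 * ‖P z‖ ≤ 3 * (B + ‖c‖ + ‖a‖) + ‖c‖ * 2 ^ 2 :=
      fun z hz => by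
    have hE1 := hElow z hz
    have hid : z ^ 2 * P z = (E z - 2) * (E z * F z - c * E z - a) + c * (E z - 1) ^ 2 := by
      have h1 : z ^ 2 * P z = (E z - 2) * (E z * (z ^ 2 * q z)) + c * (z * d z) ^ 2 := by
        simp only [hP]; ring
      rw [h1, hqG, hzd]
      simp only [hG]
      linear_combination (-a * (E z - 2)) * hEe z
    rw [← norm_pow, ← norm_mul, hid]
    refine (norm_add_le _ _).trans ?_
    rw [norm_mul, norm_mul, norm_pow]
    have hE2 : ‖E z - 2‖ ≤ 3 := (norm_sub_le _ _).trans (by norm_num; linarith)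
    have hE3 : ‖E z - 1‖ ≤ 2 := (norm_sub_le _ _).trans (by norm_num; linarith)
    have hmid : ‖E z * F z - c * E z - a‖ ≤ B + ‖c‖ + ‖a‖ := by
      refine (norm_sub_le _ _).trans (add_le_add_left ((norm_sub_le _ _).trans ?_) _)
      refine add_le_add (hB z hz) ?_
      rw [norm_mul]
      exact mul_le_of_le_one_right (norm_nonneg _) hE1
    gcongr
  set D : ℝ := 4 * (A + ‖c‖ + ‖a‖) + 4 * (3 * (B + ‖c‖ + ‖a‖) + ‖c‖ * 2 ^ 2) with hD
  have hker : ∀ s : ℝ, e s * d s ^ 2 = -((‖d s‖ ^ 2 : ℝ) : ℂ) := fun s => by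
    rcases eq_or_ne s 0 with rfl | hs
    · simp [hd0, he, mul_pow, abs_of_pos hσ]
    have hconj : (starRingEnd ℂ) (E s) = e s := by
      simp [hE, he, ← Complex.exp_conj]
    have hs' : (s : ℂ) ^ 2 ≠ 0 := by simpa using hs
    apply mul_left_cancel₀ hs'
    have h1 : (s : ℂ) ^ 2 * ((‖d s‖ ^ 2 : ℝ) : ℂ) = ((‖(s : ℂ) * d s‖ ^ 2 : ℝ) : ℂ) := by
      rw [norm_mul, mul_pow, Complex.norm_real, Real.norm_eq_abs, sq_abs]
      push_cast; rfl
    rw [mul_neg, h1, hzd, Complex.ofReal_pow, ← Complex.mul_conj', map_sub, hconj, map_one]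
    calc _ = e s * (s * d s) ^ 2 := by ring
      _ = _ := by rw [hzd]; linear_combination (E s - 1) * hEe s
  have hsplit : ∀ s : ℝ, F s * d s ^ 2 = q s + P s - a * ((‖d s‖ ^ 2 : ℝ) : ℂ) := fun s => by
    have h1 : F s = s ^ 2 * q s + c + a * e s := by rw [hqG]; simp only [hG]; ring
    have h2 : F s * d s ^ 2 = q s * (s * d s) ^ 2 + c * d s ^ 2 + a * (e s * d s ^ 2) := by
      rw [h1]; ring
    rw [h2, hker, hzd]
    simp only [hP]; ring
  have hdc : Continuous fun s : ℝ => d s := hdd.continuous.comp Complex.continuous_ofReal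
  have hqc : Continuous fun s : ℝ => q s := hqd.continuous.comp Complex.continuous_ofReal
  have hPc : Continuous fun s : ℝ => P s := hPd.continuous.comp Complex.continuous_ofReal
  have hd2 : Continuous fun s : ℝ => ‖d s‖ ^ 2 := hdc.norm.pow 2
  have hkey : ∀ R : ℝ, 0 < R →
      ‖a‖ * ∫ s in (-R)..R, ‖d s‖ ^ 2 ≤ M * (∫ s in (-R)..R, ‖d s‖ ^ 2) + D / R := by
    intro R hR
    have hRR : -R ≤ R := by linarith
    have hint : ∫ s in (-R)..R, F s * d s ^ 2 = (∫ s in (-R)..R, q s) + (∫ s in (-R)..R, P s) -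
        a * ((∫ s in (-R)..R, ‖d s‖ ^ 2 : ℝ) : ℂ) := by
      have hqPc : Continuous fun s : ℝ => q s + P s := hqc.add hPc
      have hd2c : Continuous fun s : ℝ => a * ((‖d s‖ ^ 2 : ℝ) : ℂ) := by fun_prop
      simp_rw [hsplit]
      rw [intervalIntegral.integral_sub (hqPc.intervalIntegrable _ _) (hd2c.intervalIntegrable _ _),
        intervalIntegral.integral_add (hqc.intervalIntegrable _ _) (hPc.intervalIntegrable _ _),
        intervalIntegral.integral_const_mul, intervalIntegral.integral_ofReal]
    have hK : 0 ≤ ∫ s in (-R)..R, ‖d s‖ ^ 2 :=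
      intervalIntegral.integral_nonneg hRR fun s _ => by positivity
    have hFle : ‖∫ s in (-R)..R, F s * d s ^ 2‖ ≤ M * ∫ s in (-R)..R, ‖d s‖ ^ 2 := by
      rw [← intervalIntegral.integral_const_mul]
      refine intervalIntegral.norm_integral_le_of_norm_le hRR
        (Filter.Eventually.of_forall fun s _ => ?_) ((hd2.const_mul M).intervalIntegrable _ _)
      rw [norm_mul, norm_pow]
      gcongr
      exact hM s
    have h1 := norm_integral_le_of_sq_mul_norm_le hqd hup hR
    have h2 := norm_integral_le_of_sq_mul_norm_le_lower hPd hlow hR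
    calc ‖a‖ * ∫ s in (-R)..R, ‖d s‖ ^ 2 = ‖a * ((∫ s in (-R)..R, ‖d s‖ ^ 2 : ℝ) : ℂ)‖ := by
          rw [norm_mul, Complex.norm_real, Real.norm_of_nonneg hK]
      _ = ‖(∫ s in (-R)..R, q s) + (∫ s in (-R)..R, P s) - ∫ s in (-R)..R, F s * d s ^ 2‖ := by
          rw [hint]; congr 1; ring
      _ ≤ ‖∫ s in (-R)..R, q s‖ + ‖∫ s in (-R)..R, P s‖ + ‖∫ s in (-R)..R, F s * d s ^ 2‖ :=
          (norm_sub_le _ _).trans (add_le_add_left (norm_add_le _ _) _)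
      _ ≤ 4 * (A + ‖c‖ + ‖a‖) / R + 4 * (3 * (B + ‖c‖ + ‖a‖) + ‖c‖ * 2 ^ 2) / R +
          M * ∫ s in (-R)..R, ‖d s‖ ^ 2 := by gcongr
      _ = _ := by rw [hD, add_div]; ring
  have hK1 : 0 < ∫ s in (-1 : ℝ)..1, ‖d s‖ ^ 2 := by
    refine intervalIntegral.integral_pos (by norm_num) hd2.continuousOn
      (fun s _ => by positivity) ⟨0, by norm_num, ?_⟩
    simpa [hd0] using pow_pos hσ 2
  have haM : ‖a‖ ≤ M := by
    by_contra! hlt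
    have hpos : 0 < (‖a‖ - M) * ∫ s in (-1 : ℝ)..1, ‖d s‖ ^ 2 := mul_pos (by linarith) hK1
    obtain ⟨R, hR1, hRD⟩ := ((Filter.eventually_ge_atTop (1 : ℝ)).and
      (((tendsto_const_nhds (x := D)).div_atTop Filter.tendsto_id).eventually
        (gt_mem_nhds hpos))).exists
    have hmono : ∫ s in (-1 : ℝ)..1, ‖d s‖ ^ 2 ≤ ∫ s in (-R)..R, ‖d s‖ ^ 2 :=
      intervalIntegral.integral_mono_interval (by linarith) (by norm_num) hR1
        (Filter.Eventually.of_forall fun s => by positivity) (hd2.intervalIntegrable _ _)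
    have h1 := hkey R (by linarith)
    have h2 := mul_le_mul_of_nonneg_left hmono (sub_nonneg.2 hlt.le)
    simp only [id] at hRD
    linarith
  have hderiv : deriv F 0 = a * (Complex.I * σ) := by rw [ha]; field_simp
  rw [hderiv, norm_mul, norm_mul, Complex.norm_I, one_mul, Complex.norm_real,
    Real.norm_of_nonneg hσ.le, mul_comm]
  gcongr

theorem MemEInftyPlus.comp_ofReal_add {σ : ℝ} {f : ℂ → ℂ} (hf : MemEInftyPlus σ f) (x : ℝ) :
    MemEInftyPlus σ fun z => f (x + z) := by
  obtain ⟨hd, ⟨A, hA⟩, ⟨B, hB⟩⟩ := hf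
  refine ⟨by fun_prop, ⟨A, fun z hz => hA _ (by simpa using hz)⟩, ⟨B, fun z hz => ?_⟩⟩
  have h := hB (x + z) (by simpa using hz)
  rw [norm_mul, Complex.norm_exp] at h ⊢
  simpa using h

/-- **Bernstein's inequality**. -/
theorem MemEInftyPlus.norm_deriv_le {σ : ℝ} (hσ : 0 < σ) {f : ℂ → ℂ}
    (hf : MemEInftyPlus σ f) {M : ℝ} (hM : ∀ t : ℝ, ‖f (t : ℂ)‖ ≤ M) (x : ℝ) :
    ‖deriv f x‖ ≤ σ * M := by
  have h := (hf.comp_ofReal_add x).norm_deriv_zero_le hσ (M := M)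
    fun t => by simpa using hM (x + t)
  rwa [deriv_comp_const_add, add_zero] at h

theorem MemEInftyPlus.norm_sub_le {σ : ℝ} (hσ : 0 < σ) {f : ℂ → ℂ}
    (hf : MemEInftyPlus σ f) {M : ℝ} (hM : ∀ t : ℝ, ‖f (t : ℂ)‖ ≤ M) (x t : ℝ) :
    ‖f (x : ℂ) - f (t : ℂ)‖ ≤ σ * M * |x - t| := by
  have hder : ∀ s : ℝ, HasDerivAt (fun s : ℝ => f s) (deriv f s) s :=
    fun s => (hf.1 s).hasDerivAt.comp_ofReal
  exact Convex.norm_image_sub_le_of_norm_hasDerivWithin_le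
    (fun s _ => (hder s).hasDerivWithinAt) (fun s _ => hf.norm_deriv_le hσ hM s) convex_univ
    (Set.mem_univ t) (Set.mem_univ x)

/-- The function equal to `σ² M²` on `[0, 2/σ]` and to `4 M² / u²` beyond. -/
noncomputable def truncatedInvSq (σ M u : ℝ) : ℝ :=
  if u ≤ 2 / σ then (σ * M) ^ 2 else 4 * M ^ 2 * u ^ (-2 : ℝ)

theorem integrableOn_and_integral_truncatedInvSq {σ : ℝ} (hσ : 0 < σ) (M : ℝ) :
    IntegrableOn (truncatedInvSq σ M) (Set.Ioi 0) ∧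
      ∫ u in Set.Ioi 0, truncatedInvSq σ M u = 4 * σ * M ^ 2 := by
  have ha : 0 < 2 / σ := by positivity
  have hlo : Set.EqOn (truncatedInvSq σ M) (fun _ => (σ * M) ^ 2) (Set.Ioc 0 (2 / σ)) :=
    fun u hu => if_pos hu.2
  have hhi : Set.EqOn (truncatedInvSq σ M) (fun u => 4 * M ^ 2 * u ^ (-2 : ℝ))
      (Set.Ioi (2 / σ)) := fun u hu => if_neg (not_le.2 hu)
  have hilo : IntegrableOn (truncatedInvSq σ M) (Set.Ioc 0 (2 / σ)) :=
    (integrableOn_const (by simp)).congr_fun hlo.symm measurableSet_Ioc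
  have hihi : IntegrableOn (truncatedInvSq σ M) (Set.Ioi (2 / σ)) :=
    IntegrableOn.congr_fun ((integrableOn_Ioi_rpow_of_lt (by norm_num) ha).const_mul _)
      hhi.symm measurableSet_Ioi
  rw [← Set.Ioc_union_Ioi_eq_Ioi ha.le]
  refine ⟨hilo.union hihi, ?_⟩
  rw [setIntegral_union (Set.Ioc_disjoint_Ioi le_rfl) measurableSet_Ioi hilo hihi,
    setIntegral_congr_fun measurableSet_Ioc hlo, setIntegral_congr_fun measurableSet_Ioi hhi,
    integral_const_mul, integral_Ioi_rpow_of_lt (by norm_num) ha]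
  have h : (-2 : ℝ) + 1 = -1 := by norm_num
  rw [h, Real.rpow_neg_one]
  simp only [integral_const, MeasurableSet.univ, measureReal_restrict_apply, Set.univ_inter,
    Real.volume_real_Ioc_of_le ha.le, smul_eq_mul]
  field_simp
  ring

theorem integrable_comp_abs_of_Ioi {g : ℝ → ℝ} (hg : IntegrableOn g (Set.Ioi 0)) :
    Integrable fun s => g |s| := by
  have hpos : IntegrableOn (fun s => g |s|) (Set.Ioi 0) :=
    hg.congr_fun (fun s hs => by simp [abs_of_pos (Set.mem_Ioi.1 hs)]) measurableSet_Ioi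
  have hneg : IntegrableOn (fun s => g |s|) (Set.Iic 0) := by
    have hm : MeasurableEmbedding fun s : ℝ => -s := (Homeomorph.neg ℝ).measurableEmbedding
    rw [← Measure.map_neg_eq_self (volume : Measure ℝ), hm.integrableOn_map_iff]
    simpa [Function.comp_def, integrableOn_Ici_iff_integrableOn_Ioi] using hpos
  rw [← integrableOn_univ, ← Set.Iic_union_Ioi (a := (0 : ℝ))]
  exact hneg.union hpos

/-- For `f ∈ (ℰ_σ^∞)₊` bounded by `M` on `ℝ` and any `x ∈ ℝ`,
`(1/(2πσ)) ∫_ℝ |f(x) − f(t)|²/(x − t)² dt ≤ (4/π) M²` (in particular the integral is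
finite). -/
theorem integral_bound (σ : ℝ) (hσ : 0 < σ) (f : ℂ → ℂ) (hf : MemEInftyPlus σ f)
    (M : ℝ) (hM : ∀ t : ℝ, ‖f (t : ℂ)‖ ≤ M) (x : ℝ) :
    Integrable (fun t : ℝ => ‖f (x : ℂ) - f (t : ℂ)‖ ^ 2 / (x - t) ^ 2) ∧
    (1 / (2 * Real.pi * σ)) * ∫ t : ℝ, ‖f (x : ℂ) - f (t : ℂ)‖ ^ 2 / (x - t) ^ 2
      ≤ (4 / Real.pi) * M ^ 2 := by
  obtain ⟨hGi, hGval⟩ := integrableOn_and_integral_truncatedInvSq hσ M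
  have hGabs : Integrable fun t => truncatedInvSq σ M |x - t| :=
    (integrable_comp_abs_of_Ioi hGi).comp_sub_left x
  have hle : ∀ t : ℝ, ‖f (x : ℂ) - f (t : ℂ)‖ ^ 2 / (x - t) ^ 2 ≤ truncatedInvSq σ M |x - t| := by
    intro t
    rw [← sq_abs (x - t), truncatedInvSq]
    split_ifs with h
    · refine div_le_of_le_mul₀ (by positivity) (by positivity) ?_
      rw [← mul_pow]
      gcongr
      exact hf.norm_sub_le hσ hM x t
    · have hfar : ‖f (x : ℂ) - f (t : ℂ)‖ ≤ 2 * M :=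
        (_root_.norm_sub_le _ _).trans (by linarith [hM x, hM t])
      rw [Real.rpow_neg (abs_nonneg _), Real.rpow_two, ← div_eq_mul_inv]
      gcongr
      calc _ ≤ (2 * M) ^ 2 := by gcongr
        _ = 4 * M ^ 2 := by ring
  have hcont : Continuous fun t : ℝ => f (t : ℂ) :=
    hf.1.continuous.comp Complex.continuous_ofReal
  have hint : Integrable fun t : ℝ => ‖f (x : ℂ) - f (t : ℂ)‖ ^ 2 / (x - t) ^ 2 := by
    refine hGabs.mono' ?_ (Filter.Eventually.of_forall fun t => ?_)
    · exact ((continuous_const.sub hcont).norm.pow 2).measurable.div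
        ((continuous_const.sub continuous_id).pow 2).measurable |>.aestronglyMeasurable
    · rw [Real.norm_of_nonneg (by positivity)]
      exact hle t
  refine ⟨hint, ?_⟩
  have hbound : ∫ t : ℝ, ‖f (x : ℂ) - f (t : ℂ)‖ ^ 2 / (x - t) ^ 2 ≤ 2 * (4 * σ * M ^ 2) := by
    rw [← hGval, ← integral_comp_abs,
      ← integral_sub_left_eq_self (fun s => truncatedInvSq σ M |s|) volume x]
    exact integral_mono hint hGabs hle
  calc _ ≤ 1 / (2 * Real.pi * σ) * (2 * (4 * σ * M ^ 2)) := by gcongr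
    _ = 4 / Real.pi * M ^ 2 := by
      field_simp
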